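/- There exists a fully divergent, infinite in limit basic sequence Q and a real number x such that x is Q-normal but x is not Q-distribution normal; that is, N(Q) \ DN(Q) ≠ ∅ for this Q. -/

import Mathlib

open Filter MeasureTheory Finset
open scoped Topology Classical

/-- A basic sequence: a sequence of integers, each at least `2`. -/
def IsBasic (q : ℕ → ℕ) : Prop := ∀ n, 2 ≤ q n

/-- The product `q_0 q_1 ⋯ q_{n-1}` of the first `n` terms of the basic sequence. -/
def qprod (q : ℕ → ℕ) (n : ℕ) : ℝ := ∏ i ∈ Finset.range n, (q i : ℝ)

/-- `T_{Q,n}(x) = (q_0 q_1 ⋯ q_{n-1}) x mod 1`. -/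
noncomputable def TQ (q : ℕ → ℕ) (n : ℕ) (x : ℝ) : ℝ := Int.fract (qprod q n * x)

/-- The `n`-th digit `E_n` of the `Q`-Cantor series expansion of `x`
(digit positions are indexed by `0, 1, 2, …`). -/
noncomputable def qdigit (q : ℕ → ℕ) (x : ℝ) (n : ℕ) : ℕ := ⌊(q n : ℝ) * TQ q n x⌋₊

/-- `N_n^Q(B,x)`: the number of occurrences of the block `B` starting among the first `n`
digit positions of the `Q`-Cantor series expansion of `x`. -/
noncomputable def blockCount (q : ℕ → ℕ) (x : ℝ) {k : ℕ} (B : Fin k → ℕ) (n : ℕ) : ℕ :=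
  ((Finset.range n).filter fun i => ∀ j : Fin k, qdigit q x (i + (j : ℕ)) = B j).card

/-- `Q_n^{(k)} = ∑_{j<n} 1/(q_j q_{j+1} ⋯ q_{j+k-1})`. -/
noncomputable def Qsum (q : ℕ → ℕ) (k n : ℕ) : ℝ :=
  ∑ j ∈ Finset.range n, (∏ i ∈ Finset.range k, (q (j + i) : ℝ))⁻¹

/-- `x` is `Q`-normal of order `k`: every block of length `k` occurs with the expected
asymptotic frequency. -/
def QNormalOfOrder (q : ℕ → ℕ) (k : ℕ) (x : ℝ) : Prop :=
  ∀ B : Fin k → ℕ,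
    Tendsto (fun n => (blockCount q x B n : ℝ) / Qsum q k n) atTop (𝓝 1)

/-- `x ∈ N(Q)`: `x` is `Q`-normal of every order `k ≥ 1`. -/
def QNormal (q : ℕ → ℕ) (x : ℝ) : Prop := ∀ k, 1 ≤ k → QNormalOfOrder q k x

/-- `Q` is fully divergent: `Q_n^{(k)} → ∞` for every `k ≥ 1`. -/
def FullyDivergent (q : ℕ → ℕ) : Prop :=
  ∀ k, 1 ≤ k → Tendsto (fun n => Qsum q k n) atTop atTop

/-- `Q` is infinite in limit: `q_n → ∞`. -/
def InfiniteInLimit (q : ℕ → ℕ) : Prop := Tendsto q atTop atTop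

/-- `N_{n,m,r}^Q(B,x)`: occurrences of the block `B` (of length `m`) starting at
positions `i < n` with `i ≡ r (mod m)`. -/
noncomputable def apCount (q : ℕ → ℕ) (x : ℝ) (m r : ℕ) (B : Fin m → ℕ) (n : ℕ) : ℕ :=
  ((Finset.range n).filter fun i =>
    i % m = r ∧ ∀ j : Fin m, qdigit q x (i + (j : ℕ)) = B j).card

/-- `Q_n^{(m,r)} = ∑_{j=0}^{⌊(n-r)/m⌋} 1/(q_{mj+r} q_{mj+r+1} ⋯ q_{mj+r+m-1})`. -/
noncomputable def apQsum (q : ℕ → ℕ) (m r n : ℕ) : ℝ :=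
  ∑ j ∈ Finset.range ((n - r) / m + 1),
    (∏ i ∈ Finset.range m, (q (m * j + r + i) : ℝ))⁻¹

/-- `x ∈ N^{I}_{m,r}(Q)`. -/
def MemNAPI (q : ℕ → ℕ) (m r : ℕ) (x : ℝ) : Prop :=
  ∀ B : Fin m → ℕ,
    Tendsto (fun n => (apCount q x m r B n : ℝ) / apQsum q m r n) atTop (𝓝 1)

/-- `x ∈ N^{I}_{Ab}(Q)`: `x` is AP `Q`-abnormal of type I. -/
def APAbnormalI (q : ℕ → ℕ) (x : ℝ) : Prop :=
  ∀ m, 2 ≤ m → ∀ r, r < m → ¬ MemNAPI q m r x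

/-- `x ∈ RN^{I}(Q)`. -/
def MemRNI (q : ℕ → ℕ) (x : ℝ) : Prop :=
  ∀ m, 1 ≤ m → ∀ r, r < m → ∀ B₁ B₂ : Fin m → ℕ,
    Tendsto (fun n => (apCount q x m r B₁ n : ℝ) / (apCount q x m r B₂ n : ℝ))
      atTop (𝓝 1)

/-- `Λ_{m,r}(Q) = (q_{mt+r})_t`. -/
def lamQ (q : ℕ → ℕ) (m r : ℕ) : ℕ → ℕ := fun t => q (m * t + r)

/-- `Υ_{Q,m,r}(x)`: the real number whose `Λ_{m,r}(Q)`-Cantor series digits are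
`(E_{mt+r})_t`, where `(E_n)` are the `Q`-Cantor series digits of `x`. -/
noncomputable def Ups (q : ℕ → ℕ) (m r : ℕ) (x : ℝ) : ℝ :=
  ∑' t : ℕ, (qdigit q x (m * t + r) : ℝ) / ∏ i ∈ Finset.range (t + 1), (lamQ q m r i : ℝ)

/-- `x ∈ N^{II}_{k,m,r}(Q) = Υ_{Q,m,r}^{-1}(N_k(Λ_{m,r}(Q)))`. -/
def MemNAPII (q : ℕ → ℕ) (k m r : ℕ) (x : ℝ) : Prop :=
  QNormalOfOrder (lamQ q m r) k (Ups q m r x)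

/-- `x ∈ N^{II}(Q)`: `x` is AP `Q`-normal of type II. -/
def APNormalII (q : ℕ → ℕ) (x : ℝ) : Prop :=
  ∀ k, 1 ≤ k → ∀ m, 1 ≤ m → ∀ r, r < m → MemNAPII q k m r x

/-- `x ∈ RN^{II}(Q)`: for all `k, m, r` the counts in `Υ_{Q,m,r}(x)` of any two blocks of
length `k` with respect to `Λ_{m,r}(Q)` have ratio tending to `1`. -/
def MemRNII (q : ℕ → ℕ) (x : ℝ) : Prop :=
  ∀ k, 1 ≤ k → ∀ m, 1 ≤ m → ∀ r, r < m → ∀ B₁ B₂ : Fin k → ℕ,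
    Tendsto (fun n =>
      (blockCount (lamQ q m r) (Ups q m r x) B₁ n : ℝ) /
      (blockCount (lamQ q m r) (Ups q m r x) B₂ n : ℝ)) atTop (𝓝 1)

/-- `S` (a set of positive integers) is almost closed under addition: for every `k ∈ S`,
the set `{x ∉ S : x + k ∈ S}` has asymptotic density `0`. -/
def AlmostClosed (S : Set ℕ) : Prop :=
  ∀ k ∈ S, Tendsto
    (fun t : ℕ => (((Finset.Icc 1 t).filter fun x => x ∉ S ∧ x + k ∈ S).card : ℝ) / t)
    atTop (𝓝 0)

/-- The sequence `u` of reals is uniformly distributed mod 1. -/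
def UDMod1 (u : ℕ → ℝ) : Prop :=
  ∀ a b : ℝ, 0 ≤ a → a < b → b ≤ 1 →
    Tendsto (fun N => (((Finset.range N).filter fun n => u n ∈ Set.Ico a b).card : ℝ) / N)
      atTop (𝓝 (b - a))

/-- `x ∈ DN(Q)`: `x` is `Q`-distribution normal. -/
def DistNormal (q : ℕ → ℕ) (x : ℝ) : Prop := UDMod1 fun n => TQ q n x

/-- `x ∈ DN_{Ab}(Q)`: `x` is AP `Q`-distribution abnormal. -/
def APDistAbnormal (q : ℕ → ℕ) (x : ℝ) : Prop :=
  ∀ m, 2 ≤ m → ∀ r, r < m → ¬ UDMod1 fun n => TQ q (m * n + r) x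

/-- `y ∈ D_{(x_n)}(Q)`: for every `ξ ∈ (0,1)`, the proportion of `n ≤ N` with
`fract (T_{Q,n}(y) - x_n) < ξ` tends to `1`. -/
def MemD (q : ℕ → ℕ) (xs : ℕ → ℝ) (y : ℝ) : Prop :=
  ∀ ξ : ℝ, 0 < ξ → ξ < 1 →
    Tendsto (fun N =>
      (((Finset.range N).filter fun n => Int.fract (TQ q n y - xs n) < ξ).card : ℝ) / N)
      atTop (𝓝 1)

/-- A computable real number. -/
def ComputableReal (x : ℝ) : Prop :=
  ∃ f : ℕ → ℕ, Computable f ∧ ∀ n : ℕ, 0 < n → (f n : ℝ) / n ≤ x ∧ x ≤ ((f n : ℝ) + 1) / n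

/-- The indicator function `1_{ℕ∖S}` of the complement of `S`, with values in `ℤ`. -/
noncomputable def indZ (S : Set ℕ) (i : ℕ) : ℤ := if i ∈ S then 0 else 1

/-- The indicator function `1_{ℕ∖S}` of the complement of `S`, with values in `ℝ`. -/
noncomputable def indR (S : Set ℕ) (i : ℕ) : ℝ := if i ∈ S then 0 else 1

/-- The coefficients `c_{t,i}`: `c_{t,1} = t (1+ε)^{1_{ℕ∖S}(1)}` and
`c_{t,i} = (1+ε)^{1_{ℕ∖S}(i) - 1_{ℕ∖S}(i-1)}` for `i ≥ 2`. -/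
noncomputable def coeff (S : Set ℕ) (ε : ℝ) (t i : ℕ) : ℝ :=
  if i = 1 then (t : ℝ) * (1 + ε) ^ indZ S 1
  else (1 + ε) ^ (indZ S i - indZ S (i - 1))

/-- `N_k(b)`: the set of real numbers normal of order `k` in base `b`. -/
def BaseNormalOfOrder (b k : ℕ) : Set ℝ :=
  {x | ∀ B : Fin k → ℕ, (∀ j, B j < b) →
    Tendsto (fun n => (blockCount (fun _ => b) x B n : ℝ) / n) atTop
      (𝓝 (((b : ℝ) ^ k)⁻¹))}

theorem tendsto_div_one_of_eventually_eq {f g : ℕ → ℝ} (h : ∀ᶠ n in atTop, f n = g n)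
    (hg : Tendsto (fun n => ∑ i ∈ range n, g i) atTop atTop) :
    Tendsto (fun n => (∑ i ∈ range n, f i) / ∑ i ∈ range n, g i) atTop (𝓝 1) := by
  obtain ⟨n₀, h₀⟩ := eventually_atTop.1 h
  set c : ℝ := (∑ i ∈ range n₀, f i) - ∑ i ∈ range n₀, g i
  have key : ∀ n ≥ n₀, ∑ i ∈ range n, f i = (∑ i ∈ range n, g i) + c := by
    intro n hn
    rw [← sum_range_add_sum_Ico f hn, ← sum_range_add_sum_Ico g hn,
      sum_congr rfl fun i hi => h₀ i (mem_Ico.1 hi).1]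
    ring
  have hlim : Tendsto (fun n => 1 + c / ∑ i ∈ range n, g i) atTop (𝓝 1) := by
    simpa using (tendsto_const_nhds (x := c)).div_atTop hg |>.const_add 1
  refine hlim.congr' ?_
  filter_upwards [eventually_ge_atTop n₀, hg.eventually_gt_atTop 0] with n hn hpos
  rw [key n hn]
  field_simp

/-- If `M` grows by steps of at most one and `N m` is the first time at which `M` reaches `m ^ 2`,
then convergence of `Z / M` to `1` along `N` implies convergence. -/
theorem tendsto_div_one_of_subseq {Z M : ℕ → ℝ} (hZ : Monotone Z) (hZ0 : 0 ≤ Z 0)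
    (hM : Monotone M) (hMtop : Tendsto M atTop atTop) {N : ℕ → ℕ}
    (hN : ∀ m : ℕ, (m : ℝ) ^ 2 ≤ M (N m)) (hN' : ∀ m, M (N m) ≤ (m : ℝ) ^ 2 + 1)
    (hmin : ∀ m n : ℕ, (m : ℝ) ^ 2 ≤ M n → N m ≤ n)
    (h : Tendsto (fun m => Z (N m) / M (N m)) atTop (𝓝 1)) :
    Tendsto (fun n => Z n / M n) atTop (𝓝 1) := by
  have hZn : ∀ n, 0 ≤ Z n := fun n => hZ0.trans (hZ n.zero_le)
  set φ : ℕ → ℕ := fun n => ⌊√(M n)⌋₊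
  have hφ : Tendsto φ atTop atTop :=
    tendsto_nat_floor_atTop.comp (Real.tendsto_sqrt_atTop.comp hMtop)
  have hinv : Tendsto (fun m : ℕ => 1 / ((m : ℝ) + 1)) atTop (𝓝 0) :=
    tendsto_one_div_add_atTop_nhds_zero_nat
  have hinv' : Tendsto (fun m : ℕ => 1 / (m : ℝ)) atTop (𝓝 0) :=
    tendsto_one_div_atTop_nhds_zero_nat
  have hlow : Tendsto (fun m : ℕ => (m : ℝ) ^ 2 / ((m : ℝ) + 1) ^ 2) atTop (𝓝 1) := by
    have : Tendsto (fun m : ℕ => (1 - 1 / ((m : ℝ) + 1)) ^ 2) atTop (𝓝 1) := by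
      simpa using (hinv.const_sub 1).pow 2
    refine this.congr fun m => ?_
    have : (m : ℝ) + 1 ≠ 0 := by positivity
    field_simp
    ring
  have hup : Tendsto (fun m : ℕ => (((m : ℝ) + 1) ^ 2 + 1) / (m : ℝ) ^ 2) atTop (𝓝 1) := by
    have : Tendsto (fun m : ℕ => (1 + 1 / (m : ℝ)) ^ 2 + (1 / (m : ℝ)) ^ 2) atTop (𝓝 1) := by
      simpa using ((hinv'.const_add 1).pow 2).add (hinv'.pow 2)
    refine this.congr' ?_
    filter_upwards [eventually_ge_atTop 1] with m hm
    have : (m : ℝ) ≠ 0 := by positivity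
    field_simp
  have h1 : Tendsto (fun n => Z (N (φ n)) / M (N (φ n)) * ((φ n : ℝ) ^ 2 / ((φ n : ℝ) + 1) ^ 2))
      atTop (𝓝 1) := by
    simpa [Function.comp_def] using (h.mul hlow).comp hφ
  have h2 : Tendsto (fun n => Z (N (φ n + 1)) / M (N (φ n + 1)) *
      ((((φ n : ℝ) + 1) ^ 2 + 1) / (φ n : ℝ) ^ 2)) atTop (𝓝 1) := by
    simpa [Function.comp_def] using ((h.comp (tendsto_add_atTop_nat 1)).mul hup).comp hφ
  refine tendsto_of_tendsto_of_tendsto_of_le_of_le' h1 h2 ?_ ?_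
  all_goals
    filter_upwards [hφ.eventually_ge_atTop 1, hMtop.eventually_gt_atTop 0] with n hn hpos
    have hφ1 : (1 : ℝ) ≤ φ n := by exact_mod_cast hn
    have hφ0 : (0 : ℝ) < φ n := by linarith
    have hsq : (φ n : ℝ) ^ 2 ≤ M n := by
      have := Nat.floor_le (Real.sqrt_nonneg (M n))
      calc (φ n : ℝ) ^ 2 ≤ √(M n) ^ 2 := by gcongr
        _ = M n := Real.sq_sqrt hpos.le
    have hsq' : M n < ((φ n : ℝ) + 1) ^ 2 := by
      have := Nat.lt_floor_add_one (√(M n))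
      calc M n = √(M n) ^ 2 := (Real.sq_sqrt hpos.le).symm
        _ < ((φ n : ℝ) + 1) ^ 2 := by gcongr
  · have hle : N (φ n) ≤ n := hmin _ _ hsq
    have hMpos : 0 < M (N (φ n)) := lt_of_lt_of_le (by positivity) (hN (φ n))
    calc Z (N (φ n)) / M (N (φ n)) * ((φ n : ℝ) ^ 2 / ((φ n : ℝ) + 1) ^ 2)
        = Z (N (φ n)) / ((φ n : ℝ) + 1) ^ 2 * ((φ n : ℝ) ^ 2 / M (N (φ n))) := by
          field_simp
      _ ≤ Z (N (φ n)) / ((φ n : ℝ) + 1) ^ 2 * 1 := by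
          have := hZn (N (φ n))
          have := (div_le_one hMpos).2 (hN (φ n))
          gcongr
      _ ≤ Z n / M n := by
          rw [mul_one]
          have := hZn n
          gcongr
          exact hZ hle
  · have hN1 := hN (φ n + 1)
    have hN1' := hN' (φ n + 1)
    push_cast at hN1 hN1'
    have hle : n ≤ N (φ n + 1) := by
      by_contra! hlt
      exact absurd (hN1.trans (hM hlt.le)) (not_le.2 hsq')
    have hMpos : 0 < M (N (φ n + 1)) := lt_of_lt_of_le (by positivity) hN1
    have hZ' := hZn (N (φ n + 1))
    calc Z n / M n ≤ Z (N (φ n + 1)) / (φ n : ℝ) ^ 2 * 1 := by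
          rw [mul_one]
          gcongr
          exact hZ hle
      _ ≤ Z (N (φ n + 1)) / (φ n : ℝ) ^ 2 *
          ((((φ n : ℝ) + 1) ^ 2 + 1) / M (N (φ n + 1))) := by
          have := (one_le_div hMpos).2 hN1'
          gcongr
      _ = _ := by field_simp

theorem covariance_indicator_one {Ω : Type*} [MeasurableSpace Ω] {P : Measure Ω}
    [IsProbabilityMeasure P] {A B : Set Ω} (hA : MeasurableSet A) (hB : MeasurableSet B) :
    ProbabilityTheory.covariance (A.indicator (1 : Ω → ℝ)) (B.indicator 1) P
      = P.real (A ∩ B) - P.real A * P.real B := by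
  have hL : ∀ {C : Set Ω}, MeasurableSet C → MemLp (C.indicator (1 : Ω → ℝ)) 2 P :=
    fun hC => (memLp_const (1 : ℝ)).indicator hC
  rw [ProbabilityTheory.covariance_eq_sub (hL hA) (hL hB), integral_indicator_one hA,
    integral_indicator_one hB, ← Set.inter_indicator_one, integral_indicator_one (hA.inter hB)]

/-- The number of occurring events among the first `n` has variance bounded by a constant multiple
of its mean when events at distance at least `K` are nonpositively correlated. -/
theorem variance_sum_indicator_le {Ω : Type*} [MeasurableSpace Ω] {P : Measure Ω}
    [IsProbabilityMeasure P] {A : ℕ → Set Ω} (hA : ∀ i, MeasurableSet (A i)) (K : ℕ)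
    (hK : ∀ i j, i + K ≤ j → P.real (A i ∩ A j) ≤ P.real (A i) * P.real (A j)) (n : ℕ) :
    ProbabilityTheory.variance (fun ω => ∑ i ∈ range n, (A i).indicator (1 : Ω → ℝ) ω) P
      ≤ (2 * K) * ∑ i ∈ range n, P.real (A i) := by
  have hL : ∀ i, MemLp ((A i).indicator (1 : Ω → ℝ)) 2 P :=
    fun i => (memLp_const (1 : ℝ)).indicator (hA i)
  rw [← ProbabilityTheory.covariance_self
      (Finset.aemeasurable_fun_sum _ fun i _ => (hL i).aestronglyMeasurable.aemeasurable),
    ProbabilityTheory.covariance_fun_sum_fun_sum' (fun i _ => hL i) (fun i _ => hL i), mul_sum]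
  refine sum_le_sum fun i _ => ?_
  have hbound : ∀ j, ProbabilityTheory.covariance ((A i).indicator (1 : Ω → ℝ))
      ((A j).indicator 1) P ≤ if j ∈ Ico (i + 1 - K) (i + K) then P.real (A i) else 0 := by
    intro j
    rw [covariance_indicator_one (hA i) (hA j)]
    split_ifs with hj
    · have h1 : P.real (A i ∩ A j) ≤ P.real (A i) := measureReal_mono Set.inter_subset_left
      have h2 : 0 ≤ P.real (A i) * P.real (A j) := by positivity
      linarith
    · rw [mem_Ico] at hj
      rcases le_total i j with hij | hij
      · linarith [hK i j (by omega)]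
      · have := hK j i (by omega)
        rw [Set.inter_comm, mul_comm] at this
        linarith
  calc _ ≤ ∑ j ∈ range n, if j ∈ Ico (i + 1 - K) (i + K) then P.real (A i) else 0 :=
        sum_le_sum fun j _ => hbound j
    _ = #{j ∈ range n | j ∈ Ico (i + 1 - K) (i + K)} * P.real (A i) := by
        rw [← sum_filter, sum_const, nsmul_eq_mul]
    _ ≤ (2 * K) * P.real (A i) := by
        gcongr
        have hc : #{j ∈ range n | j ∈ Ico (i + 1 - K) (i + K)} ≤ 2 * K :=
          (card_le_card fun j hj => (mem_filter.1 hj).2).trans (by rw [Nat.card_Ico]; omega)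
        exact_mod_cast hc

/-- A quantitative second Borel–Cantelli lemma for events that are nonpositively correlated at
distance at least `K`. -/
theorem ae_tendsto_sum_indicator_div {Ω : Type*} [MeasurableSpace Ω] {P : Measure Ω}
    [IsProbabilityMeasure P] {A : ℕ → Set Ω} (hA : ∀ i, MeasurableSet (A i)) (K : ℕ)
    (hK : ∀ i j, i + K ≤ j → P.real (A i ∩ A j) ≤ P.real (A i) * P.real (A j))
    (hdiv : Tendsto (fun n => ∑ i ∈ range n, P.real (A i)) atTop atTop) :
    ∀ᵐ ω ∂P, Tendsto (fun n => (∑ i ∈ range n, (A i).indicator (1 : Ω → ℝ) ω) /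
      ∑ i ∈ range n, P.real (A i)) atTop (𝓝 1) := by
  set M : ℕ → ℝ := fun n => ∑ i ∈ range n, P.real (A i) with hMdef
  set Z : ℕ → Ω → ℝ := fun n ω => ∑ i ∈ range n, (A i).indicator (1 : Ω → ℝ) ω with hZdef
  have hMmono : Monotone M := monotone_nat_of_le_succ fun n => by
    simp [hMdef, sum_range_succ]
  have hex : ∀ m : ℕ, ∃ n, (m : ℝ) ^ 2 ≤ M n := fun m => (hdiv.eventually_ge_atTop _).exists
  set N : ℕ → ℕ := fun m => Nat.find (hex m)
  have hN : ∀ m : ℕ, (m : ℝ) ^ 2 ≤ M (N m) := fun m => Nat.find_spec (hex m)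
  have hmin : ∀ m n : ℕ, (m : ℝ) ^ 2 ≤ M n → N m ≤ n := fun m n h => Nat.find_min' (hex m) h
  have hN' : ∀ m, M (N m) ≤ (m : ℝ) ^ 2 + 1 := by
    intro m
    rcases hm : N m with _ | n
    · simp only [hMdef, range_zero, sum_empty]
      positivity
    · have hlt : M n < (m : ℝ) ^ 2 := not_le.1 fun hle => by have := hmin m n hle; omega
      have : M (n + 1) = M n + P.real (A n) := sum_range_succ _ _
      have : P.real (A n) ≤ 1 := measureReal_le_one
      linarith
  have hL : ∀ i, MemLp ((A i).indicator (1 : Ω → ℝ)) 2 P :=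
    fun i => (memLp_const (1 : ℝ)).indicator (hA i)
  have hZL : ∀ n, MemLp (Z n) 2 P := fun n => memLp_finsetSum _ fun i _ => hL i
  have hmean : ∀ n, ∫ ω, Z n ω ∂P = M n := by
    intro n
    rw [integral_finsetSum _ fun i _ => (hL i).integrable (by norm_num)]
    exact sum_congr rfl fun i _ => integral_indicator_one (hA i)
  have hZmeas : ∀ n, Measurable (Z n) := fun n =>
    Finset.measurable_fun_sum _ fun i _ => measurable_one.indicator (hA i)
  set g : ℕ → Ω → ENNReal := fun m ω =>
    ENNReal.ofReal ((Z (N (m + 1)) ω / M (N (m + 1)) - 1) ^ 2) with hgdef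
  have hgmeas : ∀ m, Measurable (g m) := fun m =>
    ((((hZmeas _).div_const _).sub_const _).pow_const 2).ennreal_ofReal
  have hgint : ∀ m, ∫⁻ ω, g m ω ∂P ≤ ENNReal.ofReal (2 * K * (1 / ((m + 1 : ℕ) : ℝ) ^ 2)) := by
    intro m
    set n := N (m + 1)
    have hn := hN (m + 1)
    have hpos : 0 < M n := lt_of_lt_of_le (by positivity) hn
    have heq : ∀ ω, (Z n ω / M n - 1) ^ 2 = (1 / M n ^ 2) * (Z n ω - ∫ ω, Z n ω ∂P) ^ 2 := by
      intro ω
      rw [hmean]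
      field_simp
    have hint : Integrable (fun ω => (Z n ω - ∫ ω, Z n ω ∂P) ^ 2) P :=
      ((hZL n).sub (memLp_const _)).integrable_sq
    simp only [hgdef]
    rw [← ofReal_integral_eq_lintegral_ofReal]
    · refine ENNReal.ofReal_le_ofReal ?_
      rw [integral_congr_ae (ae_of_all _ heq), integral_const_mul,
        ← ProbabilityTheory.variance_eq_integral (hZmeas n).aemeasurable]
      calc _ ≤ 1 / M n ^ 2 * (2 * K * M n) := by
            gcongr
            exact variance_sum_indicator_le hA K hK n
        _ = 2 * K * (1 / M n) := by field_simp
        _ ≤ _ := by gcongr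
    · exact (hint.const_mul _).congr (ae_of_all _ fun ω => (heq ω).symm)
    · exact ae_of_all _ fun ω => sq_nonneg _
  have hsum : ∫⁻ ω, ∑' m, g m ω ∂P ≠ ⊤ := by
    rw [lintegral_tsum fun m => (hgmeas m).aemeasurable]
    refine ne_top_of_le_ne_top ?_ (ENNReal.tsum_le_tsum hgint)
    have hs : Summable fun m : ℕ => 2 * (K : ℝ) * (1 / ((m + 1 : ℕ) : ℝ) ^ 2) :=
      ((summable_nat_add_iff 1).2 (Real.summable_one_div_nat_pow.2 one_lt_two)).mul_left _
    rw [← ENNReal.ofReal_tsum_of_nonneg (fun m => by positivity) hs]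
    exact ENNReal.ofReal_ne_top
  filter_upwards [ae_lt_top (Measurable.tsum hgmeas) hsum] with ω hω
  refine tendsto_div_one_of_subseq (Z := fun n => Z n ω) ?_ ?_ hMmono hdiv hN hN' hmin ?_
  · refine monotone_nat_of_le_succ fun n => ?_
    simp only [hZdef, sum_range_succ, le_add_iff_nonneg_right]
    exact Set.indicator_nonneg (fun _ _ => zero_le_one) _
  · simp [hZdef]
  · rw [← tendsto_add_atTop_iff_nat 1]
    have h0 := ENNReal.tendsto_atTop_zero_of_tsum_ne_top hω.ne
    have h1 : Tendsto (fun m => (Z (N (m + 1)) ω / M (N (m + 1)) - 1) ^ 2) atTop (𝓝 0) := by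
      have := (ENNReal.tendsto_toReal ENNReal.zero_ne_top).comp h0
      refine this.congr fun m => ?_
      simp only [Function.comp, hgdef]
      exact ENNReal.toReal_ofReal (sq_nonneg _)
    have h2 := h1.sqrt
    simp only [Real.sqrt_sq_eq_abs, Real.sqrt_zero] at h2
    have h3 := ((tendsto_zero_iff_abs_tendsto_zero _).2 h2).add_const 1
    simpa using h3

/-- The value `∑ₘ d (n + m) / (q n ⋯ q (n + m))` of the tail of a Cantor series. -/
noncomputable def cantorTail (q d : ℕ → ℕ) (n : ℕ) : ℝ :=
  ∑' m : ℕ, (d (n + m) : ℝ) / ∏ i ∈ range (m + 1), (q (n + i) : ℝ)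

theorem cantorTail_term_le {q d : ℕ → ℕ} (hq : ∀ n, 4 ≤ q n) (hd : ∀ n, 2 * d n ≤ q n)
    (n m : ℕ) :
    (d (n + m) : ℝ) / ∏ i ∈ range (m + 1), (q (n + i) : ℝ) ≤ 1 / 2 * (1 / 4 : ℝ) ^ m := by
  have hq' : ∀ n, (4 : ℝ) ≤ q n := fun n => by exact_mod_cast hq n
  have hd' : (2 : ℝ) * d (n + m) ≤ q (n + m) := by exact_mod_cast hd (n + m)
  have hpow : (4 : ℝ) ^ m ≤ ∏ i ∈ range m, (q (n + i) : ℝ) := by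
    calc (4 : ℝ) ^ m = ∏ _i ∈ range m, (4 : ℝ) := by simp
      _ ≤ _ := prod_le_prod (fun _ _ => by norm_num) fun i _ => hq' _
  have hq0 := hq' (n + m)
  have hpos : 0 < ∏ i ∈ range m, (q (n + i) : ℝ) := lt_of_lt_of_le (by positivity) hpow
  rw [prod_range_succ, div_le_iff₀ (by positivity), one_div_pow]
  calc (d (n + m) : ℝ) ≤ 1 / 2 * q (n + m) := by linarith
    _ = 1 / 2 * (1 / 4 ^ m * (4 ^ m * q (n + m))) := by field_simp
    _ ≤ 1 / 2 * (1 / 4 ^ m * ((∏ i ∈ range m, (q (n + i) : ℝ)) * q (n + m))) := by gcongr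
    _ = _ := by ring

theorem summable_cantorTail {q d : ℕ → ℕ} (hq : ∀ n, 4 ≤ q n) (hd : ∀ n, 2 * d n ≤ q n)
    (n : ℕ) :
    Summable fun m : ℕ => (d (n + m) : ℝ) / ∏ i ∈ range (m + 1), (q (n + i) : ℝ) :=
  Summable.of_nonneg_of_le (fun _ => by positivity) (cantorTail_term_le hq hd n)
    ((summable_geometric_of_lt_one (by norm_num) (by norm_num)).mul_left _)

theorem cantorTail_nonneg (q d : ℕ → ℕ) (n : ℕ) : 0 ≤ cantorTail q d n :=
  tsum_nonneg fun _ => by positivity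

theorem cantorTail_le {q d : ℕ → ℕ} (hq : ∀ n, 4 ≤ q n) (hd : ∀ n, 2 * d n ≤ q n) (n : ℕ) :
    cantorTail q d n ≤ 2 / 3 := by
  have hg : Summable fun m : ℕ => 1 / 2 * (1 / 4 : ℝ) ^ m :=
    (summable_geometric_of_lt_one (by norm_num) (by norm_num)).mul_left _
  refine ((summable_cantorTail hq hd n).tsum_le_tsum (cantorTail_term_le hq hd n) hg).trans ?_
  rw [tsum_mul_left, tsum_geometric_of_lt_one (by norm_num) (by norm_num)]
  norm_num

theorem mul_cantorTail {q d : ℕ → ℕ} (hq : ∀ n, 4 ≤ q n) (hd : ∀ n, 2 * d n ≤ q n) (n : ℕ) :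
    q n * cantorTail q d n = d n + cantorTail q d (n + 1) := by
  have hq0 : (q n : ℝ) ≠ 0 := by have := hq n; positivity
  unfold cantorTail
  rw [(summable_cantorTail hq hd n).tsum_eq_zero_add, mul_add, ← tsum_mul_left]
  congr 1
  · simp
    field_simp
  · refine tsum_congr fun m => ?_
    rw [prod_range_succ' _ (m + 1), add_zero, ← mul_div_assoc, mul_comm (q n : ℝ),
      mul_div_mul_right _ _ hq0]
    simp only [add_assoc, add_comm 1]

theorem TQ_cantorTail {q d : ℕ → ℕ} (hq : ∀ n, 4 ≤ q n) (hd : ∀ n, 2 * d n ≤ q n) (n : ℕ) :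
    TQ q n (cantorTail q d 0) = cantorTail q d n := by
  have hint : ∀ n, ∃ z : ℤ, qprod q n * cantorTail q d 0 = z + cantorTail q d n := by
    intro n
    induction n with
    | zero => exact ⟨0, by simp [qprod]⟩
    | succ n ih =>
      obtain ⟨z, hz⟩ := ih
      refine ⟨q n * z + d n, ?_⟩
      have hstep : qprod q (n + 1) = qprod q n * q n := prod_range_succ _ _
      rw [hstep, mul_right_comm, hz, add_mul, mul_comm (cantorTail q d n), mul_cantorTail hq hd]
      push_cast
      ring
  obtain ⟨z, hz⟩ := hint n
  rw [TQ, hz, Int.fract_intCast_add, Int.fract_eq_self]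
  exact ⟨cantorTail_nonneg q d n, (cantorTail_le hq hd n).trans_lt (by norm_num)⟩

theorem qdigit_cantorTail {q d : ℕ → ℕ} (hq : ∀ n, 4 ≤ q n) (hd : ∀ n, 2 * d n ≤ q n) (n : ℕ) :
    qdigit q (cantorTail q d 0) n = d n := by
  rw [qdigit, TQ_cantorTail hq hd, mul_cantorTail hq hd, Nat.floor_eq_iff]
  · have := cantorTail_nonneg q d (n + 1)
    have := cantorTail_le hq hd (n + 1)
    constructor <;> linarith
  · have := cantorTail_nonneg q d (n + 1)
    positivity

theorem not_distNormal_cantorTail {q d : ℕ → ℕ} (hq : ∀ n, 4 ≤ q n) (hd : ∀ n, 2 * d n ≤ q n) :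
    ¬ DistNormal q (cantorTail q d 0) := by
  intro h
  have h1 := h (3 / 4) 1 (by norm_num) (by norm_num) le_rfl
  have h2 : ∀ n, TQ q n (cantorTail q d 0) ∉ Set.Ico (3 / 4 : ℝ) 1 := by
    intro n hn
    rw [TQ_cantorTail hq hd] at hn
    linarith [hn.1, cantorTail_le hq hd n]
  simp only [h2, filter_false, card_empty, Nat.cast_zero, zero_div] at h1
  have := tendsto_nhds_unique h1 tendsto_const_nhds
  norm_num at this

/-- A slowly growing basic sequence. -/
def logBasic (n : ℕ) : ℕ := Nat.log 2 n + 4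

theorem infiniteInLimit_logBasic : InfiniteInLimit logBasic := by
  refine tendsto_atTop_mono (fun n => Nat.le_add_right _ 4) ?_
  refine tendsto_atTop_atTop.2 fun b => ⟨2 ^ b, fun n hn => ?_⟩
  exact Nat.le_log_of_pow_le one_lt_two hn

theorem exists_logBasic_pow_le (k : ℕ) :
    ∃ C : ℝ, 0 < C ∧ ∀ n, 1 ≤ n → (logBasic n : ℝ) ^ k ≤ C * n := by
  obtain ⟨C, hC⟩ :=
    (tendsto_pow_const_div_const_pow_of_one_lt k (one_lt_two (α := ℝ))).bddAbove_range
  refine ⟨16 * max C 1, by positivity, fun n hn => ?_⟩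
  have h1 : ((Nat.log 2 n + 4 : ℕ) : ℝ) ^ k / 2 ^ (Nat.log 2 n + 4) ≤ max C 1 :=
    (hC ⟨Nat.log 2 n + 4, rfl⟩).trans (le_max_left _ _)
  have h2 : (2 : ℝ) ^ Nat.log 2 n ≤ n := by exact_mod_cast Nat.pow_log_le_self 2 (by omega)
  rw [div_le_iff₀ (by positivity), pow_add] at h1
  calc (logBasic n : ℝ) ^ k ≤ max C 1 * (2 ^ Nat.log 2 n * 2 ^ 4) := h1
    _ ≤ max C 1 * (n * 2 ^ 4) := by gcongr
    _ = _ := by ring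

theorem fullyDivergent_logBasic : FullyDivergent logBasic := by
  intro k hk
  have hnn : ∀ j, 0 ≤ (∏ i ∈ range k, (logBasic (j + i) : ℝ))⁻¹ := fun j => by positivity
  refine (not_summable_iff_tendsto_nat_atTop_of_nonneg hnn).1 fun hs => ?_
  obtain ⟨C, hC, hbound⟩ := exists_logBasic_pow_le k
  refine Real.not_summable_natCast_inv ((summable_nat_add_iff k).1 ?_)
  refine Summable.of_nonneg_of_le (fun j => by positivity) (fun j => ?_) (hs.mul_left C)
  have hprod : ∏ i ∈ range k, (logBasic (j + i) : ℝ) ≤ C * ((j + k : ℕ) : ℝ) := by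
    refine le_trans ?_ (hbound (j + k) (by omega))
    calc _ ≤ ∏ _i ∈ range k, (logBasic (j + k) : ℝ) := by
          refine prod_le_prod (fun _ _ => by positivity) fun i hi => ?_
          have : j + i ≤ j + k := by have := mem_range.1 hi; omega
          exact_mod_cast Nat.add_le_add_right (Nat.log_mono_right this) 4
      _ = _ := by simp
  have hpos : 0 < ∏ i ∈ range k, (logBasic (j + i) : ℝ) :=
    prod_pos fun i _ => by simp [logBasic]; positivity
  have hjk : (0 : ℝ) < ((j + k : ℕ) : ℝ) := by exact_mod_cast (by omega : 0 < j + k)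
  rw [← div_eq_mul_inv, le_div_iff₀ hpos, inv_mul_le_iff₀ hjk]
  linarith

theorem tendsto_atTop_of_div_tendsto_one {f g : ℕ → ℝ}
    (h : Tendsto (fun n => f n / g n) atTop (𝓝 1)) (hg : Tendsto g atTop atTop) :
    Tendsto f atTop atTop := by
  refine (h.pos_mul_atTop one_pos hg).congr' ?_
  filter_upwards [hg.eventually_gt_atTop 0] with n hn
  exact div_mul_cancel₀ _ hn.ne'

theorem tendsto_div_one_trans {f g h : ℕ → ℝ} (hfg : Tendsto (fun n => f n / g n) atTop (𝓝 1))
    (hgh : Tendsto (fun n => g n / h n) atTop (𝓝 1)) (hg : Tendsto g atTop atTop) :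
    Tendsto (fun n => f n / h n) atTop (𝓝 1) := by
  have := hfg.mul hgh
  rw [one_mul] at this
  refine this.congr' ?_
  filter_upwards [hg.eventually_gt_atTop 0] with n hn
  exact div_mul_div_cancel₀ hn.ne'

/-- The uniform probability measure on `{0, …, m - 1}`. -/
noncomputable def uniformDigit (m : ℕ) [NeZero m] : Measure ℕ :=
  (PMF.uniformOfFinset (range m) (nonempty_range_iff.2 (NeZero.ne m))).toMeasure

instance (m : ℕ) [NeZero m] : IsProbabilityMeasure (uniformDigit m) := by
  unfold uniformDigit
  infer_instance

theorem uniformDigit_singleton {m : ℕ} [NeZero m] {b : ℕ} (hb : b < m) :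
    uniformDigit m {b} = (m : ENNReal)⁻¹ := by
  rw [uniformDigit, PMF.toMeasure_apply_singleton _ _ (measurableSet_singleton b),
    PMF.uniformOfFinset_apply_of_mem _ (mem_range.2 hb), card_range]

/-- The digit sequences in which the block `B` occurs at position `i`. -/
def blockEvent {k : ℕ} (B : Fin k → ℕ) (i : ℕ) : Set (ℕ → ℕ) :=
  {ω | ∀ j : Fin k, ω (i + j) = B j}

/-- The values at position `n` compatible with an occurrence of `B` at position `i`. -/
def blockValues {k : ℕ} (B : Fin k → ℕ) (i n : ℕ) : Set ℕ :=
  {m | ∀ j : Fin k, n = i + j → m = B j}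

theorem blockValues_eq_univ {k : ℕ} (B : Fin k → ℕ) {i n : ℕ} (hn : n ∉ Ico i (i + k)) :
    blockValues B i n = Set.univ := by
  refine Set.eq_univ_of_forall fun m j hj => absurd ?_ hn
  rw [mem_Ico]
  omega

theorem blockValues_add {k : ℕ} (B : Fin k → ℕ) (i : ℕ) (j : Fin k) :
    blockValues B i (i + j) = {B j} := by
  ext m
  refine ⟨fun h => h j rfl, ?_⟩
  rintro rfl l hl
  rw [Fin.ext (Nat.add_left_cancel hl)]

theorem blockEvent_eq_pi {k : ℕ} (B : Fin k → ℕ) (i : ℕ) :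
    blockEvent B i = Set.pi (Ico i (i + k) : Finset ℕ) (blockValues B i) := by
  ext ω
  refine ⟨?_, fun h j => h (i + j) (by simp) j rfl⟩
  rintro h _ - j rfl
  exact h j

theorem measurableSet_blockEvent {k : ℕ} (B : Fin k → ℕ) (i : ℕ) :
    MeasurableSet (blockEvent B i) := by
  rw [blockEvent_eq_pi]
  exact MeasurableSet.pi (Finset.countable_toSet _) fun _ _ => MeasurableSet.of_discrete

theorem infinitePi_blockEvent_inter (μ : ℕ → Measure ℕ) [∀ n, IsProbabilityMeasure (μ n)]
    {k : ℕ} (B : Fin k → ℕ) {i j : ℕ} (hij : i + k ≤ j) :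
    Measure.infinitePi μ (blockEvent B i ∩ blockEvent B j)
      = Measure.infinitePi μ (blockEvent B i) * Measure.infinitePi μ (blockEvent B j) := by
  have hdisj : Disjoint (Ico i (i + k)) (Ico j (j + k)) := by
    rw [disjoint_left]
    intro n hn hn'
    rw [mem_Ico] at hn hn'
    omega
  have hinter : blockEvent B i ∩ blockEvent B j
      = Set.pi (Ico i (i + k) ∪ Ico j (j + k) : Finset ℕ)
        (fun n => blockValues B i n ∩ blockValues B j n) := by
    rw [blockEvent_eq_pi, blockEvent_eq_pi]
    ext ω
    simp only [coe_union, Set.mem_inter_iff, Set.mem_pi, Set.mem_union, mem_coe]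
    refine ⟨fun h n _ => ⟨?_, ?_⟩, fun h => ⟨fun n hn => (h n (.inl hn)).1,
      fun n hn => (h n (.inr hn)).2⟩⟩
    · by_cases hn : n ∈ Ico i (i + k)
      · exact h.1 n hn
      · simp [blockValues_eq_univ B hn]
    · by_cases hn : n ∈ Ico j (j + k)
      · exact h.2 n hn
      · simp [blockValues_eq_univ B hn]
  rw [hinter, blockEvent_eq_pi, blockEvent_eq_pi,
    Measure.infinitePi_pi _ fun _ _ => MeasurableSet.of_discrete,
    Measure.infinitePi_pi _ fun _ _ => MeasurableSet.of_discrete,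
    Measure.infinitePi_pi _ fun _ _ => MeasurableSet.of_discrete, prod_union hdisj]
  congr 1
  · refine prod_congr rfl fun n hn => ?_
    rw [blockValues_eq_univ B (disjoint_left.1 hdisj hn), Set.inter_univ]
  · refine prod_congr rfl fun n hn => ?_
    rw [blockValues_eq_univ B (disjoint_right.1 hdisj hn), Set.univ_inter]

theorem infinitePi_uniformDigit_blockEvent {q : ℕ → ℕ} [∀ n, NeZero (q n)] {k : ℕ}
    (B : Fin k → ℕ) {i : ℕ} (hB : ∀ j : Fin k, B j < q (i + j)) :
    (Measure.infinitePi fun n => uniformDigit (q n)).real (blockEvent B i)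
      = (∏ l ∈ range k, (q (i + l) : ℝ))⁻¹ := by
  rw [Measure.real, blockEvent_eq_pi,
    Measure.infinitePi_pi _ fun _ _ => MeasurableSet.of_discrete, ENNReal.toReal_prod,
    prod_Ico_eq_prod_range, Nat.add_sub_cancel_left, ← prod_inv_distrib]
  refine prod_congr rfl fun l hl => ?_
  rw [blockValues_add B i ⟨l, mem_range.1 hl⟩, uniformDigit_singleton (hB ⟨l, mem_range.1 hl⟩)]
  simp

/-- Almost every digit sequence contains every block with the expected asymptotic frequency. -/
theorem exists_normal_digits {q : ℕ → ℕ} [∀ n, NeZero (q n)] (hdiv : FullyDivergent q)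
    (hinf : InfiniteInLimit q) :
    ∃ ω : ℕ → ℕ, ∀ k, 1 ≤ k → ∀ B : Fin k → ℕ,
      Tendsto (fun n => (∑ i ∈ range n, (blockEvent B i).indicator (1 : (ℕ → ℕ) → ℝ) ω) /
        Qsum q k n) atTop (𝓝 1) := by
  set P := Measure.infinitePi fun n => uniformDigit (q n)
  have hae : ∀ᵐ ω ∂P, ∀ k, 1 ≤ k → ∀ B : Fin k → ℕ,
      Tendsto (fun n => (∑ i ∈ range n, (blockEvent B i).indicator (1 : (ℕ → ℕ) → ℝ) ω) /
        Qsum q k n) atTop (𝓝 1) := by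
    simp only [ae_all_iff]
    intro k hk B
    have hev : ∀ᶠ i in atTop, P.real (blockEvent B i)
        = (∏ l ∈ range k, (q (i + l) : ℝ))⁻¹ := by
      have hlt : ∀ᶠ i in atTop, ∀ j : Fin k, B j < q (i + j) :=
        eventually_all.2 fun j =>
          (hinf.comp (tendsto_add_atTop_nat (j : ℕ))).eventually_gt_atTop (B j)
      exact hlt.mono fun i hi => infinitePi_uniformDigit_blockEvent B hi
    have hratio := tendsto_div_one_of_eventually_eq hev (hdiv k hk)
    have htop := tendsto_atTop_of_div_tendsto_one hratio (hdiv k hk)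
    filter_upwards [ae_tendsto_sum_indicator_div (measurableSet_blockEvent B) k
      (fun i j hij => by
        simp only [Measure.real, P, infinitePi_blockEvent_inter _ B hij, ENNReal.toReal_mul,
          le_refl]) htop] with ω hω
    exact tendsto_div_one_trans hω hratio htop
  exact hae.exists

/-- Capping the digits at half the base does not affect normality. -/
theorem qNormal_cantorTail_min {q : ℕ → ℕ} (hq : ∀ n, 4 ≤ q n) (hdiv : FullyDivergent q)
    (hinf : InfiniteInLimit q) {ω : ℕ → ℕ}
    (hω : ∀ k, 1 ≤ k → ∀ B : Fin k → ℕ,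
      Tendsto (fun n => (∑ i ∈ range n, (blockEvent B i).indicator (1 : (ℕ → ℕ) → ℝ) ω) /
        Qsum q k n) atTop (𝓝 1)) :
    QNormal q (cantorTail q (fun n => min (ω n) (q n / 2)) 0) := by
  intro k hk B
  have hω' := hω k hk B
  have htop := tendsto_atTop_of_div_tendsto_one hω' (hdiv k hk)
  refine tendsto_div_one_trans ?_ hω' htop
  simp only [blockCount, card_filter, Nat.cast_sum]
  refine tendsto_div_one_of_eventually_eq ?_ htop
  have hlt : ∀ᶠ i in atTop, ∀ j : Fin k, 2 * (B j + 1) < q (i + j) :=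
    eventually_all.2 fun j =>
      (hinf.comp (tendsto_add_atTop_nat (j : ℕ))).eventually_gt_atTop (2 * (B j + 1))
  filter_upwards [hlt] with i hi
  have hiff : (∀ j : Fin k, min (ω (i + j)) (q (i + j) / 2) = B j) ↔ ω ∈ blockEvent B i :=
    forall_congr' fun j => by have := hi j; omega
  have hd : ∀ n, 2 * min (ω n) (q n / 2) ≤ q n := fun n => by omega
  simp only [qdigit_cantorTail hq hd, hiff, Set.indicator_apply, Pi.one_apply]
  split_ifs <;> simp

/-- There exist a fully divergent, infinite in limit basic sequence `Q` and a real number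
`x` which is `Q`-normal but not `Q`-distribution normal. -/
theorem stmt15 :
    ∃ Q : ℕ → ℕ, IsBasic Q ∧ FullyDivergent Q ∧ InfiniteInLimit Q ∧
      ∃ x : ℝ, QNormal Q x ∧ ¬ DistNormal Q x := by
  have hq : ∀ n, 4 ≤ logBasic n := fun n => Nat.le_add_left 4 _
  have : ∀ n, NeZero (logBasic n) := fun n => ⟨by have := hq n; omega⟩
  obtain ⟨ω, hω⟩ := exists_normal_digits fullyDivergent_logBasic infiniteInLimit_logBasic
  exact ⟨logBasic, fun n => le_trans (by norm_num) (hq n), fullyDivergent_logBasic,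
    infiniteInLimit_logBasic, _,
    qNormal_cantorTail_min hq fullyDivergent_logBasic infiniteInLimit_logBasic hω,
    not_distNormal_cantorTail hq fun n => by omega⟩
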